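/- (Barycenter swap lemma) Let m ≥ 2, let γ_1 ≤ γ_2 ≤ … ≤ γ_m be real numbers, let T > 0 and c ∈ ℝ, and let Ṽ = {s̃ ∈ [0,∞)^m : Σ_{i=1}^m s̃_i = T and Σ_{i=1}^m γ_i s̃_i ≥ c}, regarded as a subset of the affine hyperplane H = {s̃ : Σ_{i=1}^m s̃_i = T} endowed with its (m−1)-dimensional surface (Hausdorff) measure. Assume Ṽ has positive finite measure. Then the barycenter q̃ = (q̃_1,…,q̃_m) of Ṽ (the componentwise mean with respect to the normalized surface measure) satisfies q̃_i ≤ q̃_{i+1} for every 1 ≤ i ≤ m−1. -/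

import Mathlib

open MeasureTheory Finset

/-- If `V` is finite for a measure preserved by the involution `σ`, `f` is integrable on `V` and odd
under `σ`, and `σ` maps the part of `V` where `f` is negative into `V`, then `f` has a nonnegative
integral over `V`. -/
lemma setIntegral_nonneg_of_odd_involutive {α : Type*} [MeasurableSpace α] {μ : Measure α}
    {σ : α ≃ᵐ α} (hσ : MeasurePreserving σ μ μ) (hinv : Function.Involutive σ) {V : Set α}
    (hV : MeasurableSet V) {f : α → ℝ} (hf : IntegrableOn f V μ) (hodd : ∀ s, f (σ s) = -f s)
    (hmaps : ∀ s ∈ V, f s < 0 → σ s ∈ V) : 0 ≤ ∫ s in V, f s ∂μ := by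
  classical
  rw [← integral_indicator hV]
  have hi : Integrable (V.indicator f) μ := (integrable_indicator_iff hV).2 hf
  have hi' : Integrable (fun s => V.indicator f (σ s)) μ := hσ.integrable_comp_of_integrable hi
  have heq : ∫ s, V.indicator f (σ s) ∂μ = ∫ s, V.indicator f s ∂μ :=
    hσ.integral_comp σ.measurableEmbedding _
  have hsum : 0 ≤ ∫ s, (V.indicator f s + V.indicator f (σ s)) ∂μ := by
    refine integral_nonneg fun s => ?_
    have h1 := hmaps s
    have h2 := hmaps (σ s)
    rw [hinv s, hodd s] at h2
    simp only [Pi.zero_apply, Set.indicator_apply, hodd]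
    by_cases hs : s ∈ V <;> by_cases hs' : σ s ∈ V <;> simp only [hs, hs', if_true, if_false]
    · linarith
    · by_contra! h
      exact hs' (h1 hs (by linarith))
    · by_contra! h
      exact hs (h2 hs' (by linarith))
    · simp
  rw [integral_add hi hi', heq] at hsum
  linarith

/-- Exchanging two weights changes a weighted sum by the product of the differences. -/
lemma sum_mul_comp_swap {ι : Type*} [Fintype ι] [DecidableEq ι] {i j : ι} (hij : i ≠ j)
    (w x : ι → ℝ) :
    ∑ k, w k * x (Equiv.swap i j k) = ∑ k, w k * x k + (w j - w i) * (x i - x j) := by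
  have key : ∑ k, (w k * x (Equiv.swap i j k) - w k * x k) =
      (w i * x j - w i * x i) + (w j * x i - w j * x j) := by
    rw [Fintype.sum_eq_add i j hij]
    · simp
    · rintro k ⟨hki, hkj⟩
      simp [Equiv.swap_apply_of_ne_of_ne hki hkj]
  rw [Finset.sum_sub_distrib] at key
  linarith

/-- Barycenter swap lemma: if `γ₁ ≤ … ≤ γ_m`, `T > 0`, and
`Ṽ = {s ∈ [0,∞)^m : Σ s_i = T, Σ γ_i s_i ≥ c}` has positive finite
`(m-1)`-dimensional Hausdorff (surface) measure, then the barycenter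
`q̃` of `Ṽ` (componentwise mean w.r.t. the normalized surface measure)
has non-decreasing components: `q̃_i ≤ q̃_{i+1}`. -/
theorem stmt17 (m : ℕ) (hm : 2 ≤ m) (γ : Fin m → ℝ) (hγ : Monotone γ)
    (T : ℝ) (hT : 0 < T) (c : ℝ)
    (Vt : Set (EuclideanSpace ℝ (Fin m)))
    (hVt : Vt = {s | (∀ i, 0 ≤ s i) ∧ (∑ i, s i) = T ∧ c ≤ ∑ i, γ i * s i})
    (hpos : 0 < μH[(m : ℝ) - 1] Vt) (hfin : μH[(m : ℝ) - 1] Vt < ⊤) :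
    ∀ i : Fin m, ∀ h : (i : ℕ) + 1 < m,
      (∫ s in Vt, s i ∂μH[(m : ℝ) - 1]) / (μH[(m : ℝ) - 1] Vt).toReal ≤
        (∫ s in Vt, s ⟨(i : ℕ) + 1, h⟩ ∂μH[(m : ℝ) - 1]) /
          (μH[(m : ℝ) - 1] Vt).toReal := by
  intro i h
  set j : Fin m := ⟨(i : ℕ) + 1, h⟩ with hj
  have hij : i ≠ j := by
    intro h'
    have := congrArg Fin.val h'
    simp [hj] at this
  have hle : γ i ≤ γ j := hγ (Fin.le_def.2 (by simp [hj]))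
  have hmeas : MeasurableSet Vt := by
    have hclosed : IsClosed Vt := by
      rw [hVt, Set.ofPred_and, Set.ofPred_and, Set.ofPred_forall]
      refine (isClosed_iInter fun k => isClosed_le (by fun_prop) (by fun_prop)).inter
        ((isClosed_eq (by fun_prop) (by fun_prop)).inter (isClosed_le (by fun_prop) (by fun_prop)))
    exact hclosed.measurableSet
  have hint : ∀ k, IntegrableOn (fun s : EuclideanSpace ℝ (Fin m) => s k) Vt
      μH[(m : ℝ) - 1] := by
    intro k
    refine Measure.integrableOn_of_bounded (M := T) hfin.ne
      (Continuous.aestronglyMeasurable (by fun_prop)) ?_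
    refine (ae_restrict_iff' hmeas).2 (Filter.Eventually.of_forall fun s hs => ?_)
    rw [hVt] at hs
    rw [Real.norm_of_nonneg (hs.1 k), ← hs.2.1]
    exact Finset.single_le_sum (fun l _ => hs.1 l) (Finset.mem_univ k)
  let σ : EuclideanSpace ℝ (Fin m) ≃ₗᵢ[ℝ] EuclideanSpace ℝ (Fin m) :=
    LinearIsometryEquiv.piLpCongrLeft 2 ℝ ℝ (Equiv.swap i j)
  have hσ : ∀ s k, σ s k = s (Equiv.swap i j k) := by
    intro s k
    simp [σ, LinearIsometryEquiv.piLpCongrLeft_apply, Equiv.piCongrLeft'_apply]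
  refine div_le_div_of_nonneg_right ?_ ENNReal.toReal_nonneg
  rw [← sub_nonneg, ← integral_sub (hint j) (hint i)]
  refine setIntegral_nonneg_of_odd_involutive (σ := σ.toHomeomorph.toMeasurableEquiv)
    (σ.toIsometryEquiv.measurePreserving_hausdorffMeasure _) ?_ hmeas ((hint j).sub (hint i)) ?_ ?_
  · intro s
    ext k
    change σ (σ s) k = s k
    simp [hσ]
  · intro s
    change σ s j - σ s i = -(s j - s i)
    simp [hσ]
  · intro s hs hlt
    change σ s ∈ Vt
    rw [hVt] at hs ⊢
    refine ⟨fun k => ?_, ?_, ?_⟩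
    · rw [hσ]
      exact hs.1 _
    · simp only [hσ]
      rw [Equiv.sum_comp (Equiv.swap i j) (fun k => s k)]
      exact hs.2.1
    · simp only [hσ]
      rw [sum_mul_comp_swap hij γ (fun k => s k)]
      have := mul_nonneg (sub_nonneg.2 hle) (by linarith : 0 ≤ s i - s j)
      linarith [hs.2.2]
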